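/- Fix integers n, m, k ≥ 2 with n+m+k ≥ 7 and set ℓ = n+m+k. Let 0 < x_1 < … < x_n, 0 < y_1 < … < y_m, 0 < z_1 < … < z_k be reals, let μ = (μ_1, …, μ_ℓ) be nonnegative integers with 0 ≤ μ_1 ≤ μ_2 ≤ μ_3 < μ_4 < … < μ_ℓ, and let M ≥ 2(μ_1+⋯+μ_ℓ). For τ > 0 define the ℓ×ℓ matrix ℰ(τ) whose columns 1..n are x-columns, columns n+1..n+m are y-columns, and columns n+m+1..ℓ are z-columns, with: row 1 equal to (x_j τ²)^{μ_1} in the x-columns and 0 elsewhere; row 2 equal to (y_j τ)^{μ_2} in the y-columns and 0 elsewhere; row 3 equal to z_j^{μ_3} in the z-columns and 0 elsewhere; row 4 equal to (x_j τ²)^{μ_4}, τ^M (y_j τ)^{μ_4}, τ^M z_j^{μ_4} in the x-, y-, z-columns respectively; row 5 equal to τ^M (x_j τ²)^{μ_5}, (y_j τ)^{μ_5}, τ^M z_j^{μ_5}; row 6 equal to τ^M (x_j τ²)^{μ_6}, τ^M (y_j τ)^{μ_6}, z_j^{μ_6}; and row i for 7 ≤ i ≤ ℓ equal to (x_j τ²)^{μ_i},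 (y_j τ)^{μ_i}, z_j^{μ_i}. Let E(τ) = −det ℰ(τ). Then there exist constants C' > 0 (independent of τ), c ≥ 0 and τ_0 > 0 such that |E(τ) − C' τ^ξ| ≤ c τ^{ξ+1} for all 0 < τ < τ_0, where ξ = 2(μ_1 + μ_4 + Σ_{i=7}^{n+4} μ_i) + μ_2 + μ_5 + Σ_{i=n+5}^{n+m+2} μ_i. -/

import Mathlib

noncomputable section

/-- The `(n+m+k) × (n+m+k)` matrix `ℰ(τ)` of Lemma `lem:det3`: rows are indexed 1-based by
`(r:ℕ)+1`; columns `1..n` are `x`-columns (scaled by `τ²`), columns `n+1..n+m` are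
`y`-columns (scaled by `τ`) and columns `n+m+1..n+m+k` are `z`-columns (unscaled).
Row `1` (resp. `2`, `3`) is supported on the `x`- (resp. `y`-, `z`-) columns; rows `4,5,6`
carry the factor `τ^M` except on the `x`- (resp. `y`-, `z`-) columns; rows `≥ 7` are plain. -/
noncomputable def mat19 (n m k : ℕ) (x : Fin n → ℝ) (y : Fin m → ℝ) (z : Fin k → ℝ)
    (μ : ℕ → ℕ) (M τ : ℝ) : Matrix (Fin (n + m + k)) (Fin (n + m + k)) ℝ :=
  Matrix.of fun r c =>
    if hc : (c : ℕ) < n then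
      (if (r : ℕ) + 1 = 2 ∨ (r : ℕ) + 1 = 3 then 0
       else if (r : ℕ) + 1 = 5 ∨ (r : ℕ) + 1 = 6 then
         τ ^ M * (x ⟨(c : ℕ), hc⟩ * τ ^ 2) ^ μ ((r : ℕ) + 1)
       else (x ⟨(c : ℕ), hc⟩ * τ ^ 2) ^ μ ((r : ℕ) + 1))
    else if hc' : (c : ℕ) < n + m then
      (if (r : ℕ) + 1 = 1 ∨ (r : ℕ) + 1 = 3 then 0
       else if (r : ℕ) + 1 = 4 ∨ (r : ℕ) + 1 = 6 then
         τ ^ M * (y ⟨(c : ℕ) - n, by omega⟩ * τ) ^ μ ((r : ℕ) + 1)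
       else (y ⟨(c : ℕ) - n, by omega⟩ * τ) ^ μ ((r : ℕ) + 1))
    else
      (if (r : ℕ) + 1 = 1 ∨ (r : ℕ) + 1 = 2 then 0
       else if (r : ℕ) + 1 = 4 ∨ (r : ℕ) + 1 = 5 then
         τ ^ M * z ⟨(c : ℕ) - n - m, by have := c.isLt; omega⟩ ^ μ ((r : ℕ) + 1)
       else z ⟨(c : ℕ) - n - m, by have := c.isLt; omega⟩ ^ μ ((r : ℕ) + 1))

/-- The exponent `ξ = 2(μ₁ + μ₄ + ∑_{i=7}^{n+4} μ_i) + μ₂ + μ₅ + ∑_{i=n+5}^{n+m+2} μ_i`. -/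
noncomputable def xi19 (n m : ℕ) (μ : ℕ → ℕ) : ℝ :=
  2 * ((μ 1 : ℝ) + (μ 4 : ℝ) + ∑ i ∈ Finset.Icc 7 (n + 4), (μ i : ℝ)) +
    (μ 2 : ℝ) + (μ 5 : ℝ) + ∑ i ∈ Finset.Icc (n + 5) (n + m + 2), (μ i : ℝ)

open Polynomial in
/-- The number of sign variations is less than the number of nonzero coefficients. -/
theorem Polynomial.signVariations_lt_card_support {P : ℝ[X]} (hP : P ≠ 0) :
    P.signVariations < P.support.card := by
  induction hs : P.support.card generalizing P with
  | zero => exact absurd (by simpa using hs) hP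
  | succ s ih =>
    by_cases h : P.eraseLead = 0
    · have := signVariations_eq_eraseLead_add_ite hP
      simp [h, hP] at this
      omega
    · have h1 := ih h (by rw [card_support_eraseLead, hs, Nat.add_sub_cancel])
      have h2 := P.signVariations_le_eraseLead_succ
      omega

open Polynomial in
/-- A generalized Vandermonde matrix with positive increasing nodes and increasing exponents has
positive determinant. -/
theorem det_generalizedVandermonde_pos (N : ℕ) (v : Fin N → ℝ) (hv : ∀ j, 0 < v j)
    (hvm : StrictMono v) (ν : Fin N → ℕ) (hν : StrictMono ν) :
    0 < (Matrix.of fun i j => v j ^ ν i).det := by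
  induction N with
  | zero => simp
  | succ N ih =>
    set a : Fin (N + 1) → ℝ := fun i => (-1) ^ (i + N : ℕ) *
      (Matrix.of fun (p q : Fin N) => v q.castSucc ^ ν (i.succAbove p)).det with ha
    set P : ℝ[X] := ∑ i, monomial (ν i) (a i) with hPdef
    have heval : ∀ t, P.eval t =
        (Matrix.of fun i j => (Fin.snoc (fun q => v q.castSucc) t : Fin (N + 1) → ℝ) j ^ ν i).det := by
      intro t
      rw [Matrix.det_succ_column _ (Fin.last N), hPdef, eval_finsetSum]
      refine Finset.sum_congr rfl fun i _ => ?_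
      simp only [eval_monomial, ha, Fin.val_last, Matrix.of_apply, Fin.snoc_last]
      rw [mul_right_comm]
      congr 3
      ext p q
      simp
    have hcoeff : ∀ d, P.coeff d = ∑ i, if ν i = d then a i else 0 := by
      intro d
      simp [hPdef, coeff_monomial]
    have halast : 0 < a (Fin.last N) := by
      have := ih (fun q => v q.castSucc) (fun j => hv _) (hvm.comp (Fin.strictMono_castSucc))
        (fun p => ν p.castSucc) (hν.comp (Fin.strictMono_castSucc))
      simpa [ha, ← two_mul] using this
    have hlast : P.coeff (ν (Fin.last N)) = a (Fin.last N) := by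
      rw [hcoeff]
      simp [hν.injective.eq_iff]
    have hP0 : P ≠ 0 := by
      intro h
      rw [h] at hlast
      simp at hlast
      linarith
    have hdeg : P.natDegree ≤ ν (Fin.last N) := by
      rw [natDegree_le_iff_coeff_eq_zero]
      intro d hd
      rw [hcoeff]
      refine Finset.sum_eq_zero fun i _ => if_neg ?_
      have := hν.monotone (Fin.le_last i)
      omega
    have hlc : 0 ≤ P.leadingCoeff := by
      have : P.natDegree = ν (Fin.last N) :=
        le_antisymm hdeg (le_natDegree_of_ne_zero (by rw [hlast]; exact halast.ne'))
      rw [leadingCoeff, this, hlast]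
      exact halast.le
    have hsupp : P.support.card ≤ N + 1 := by
      have : P.support ⊆ Finset.univ.image ν := by
        intro d hd
        rw [mem_support_iff, hcoeff] at hd
        obtain ⟨i, -, hi⟩ := Finset.exists_ne_zero_of_sum_ne_zero hd
        simp only [ne_eq, ite_eq_right_iff, Classical.not_imp] at hi
        exact Finset.mem_image.2 ⟨i, Finset.mem_univ _, hi.1⟩
      exact (Finset.card_le_card this).trans (Finset.card_image_le.trans (by simp))
    have hroot : ∀ q : Fin N, P.eval (v q.castSucc) = 0 := by
      intro q
      rw [heval]
      refine Matrix.det_zero_of_column_eq (Fin.castSucc_lt_last q).ne fun i => ?_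
      simp
    have key : 0 < P.eval (v (Fin.last N)) := by
      refine zero_lt_eval_of_roots_lt_of_leadingCoeff_nonneg (fun y hy => ?_) hlc
      by_contra! hle
      have hinj : Function.Injective (Fin.snoc (fun q => v q.castSucc) y : Fin (N + 1) → ℝ) := by
        rw [Fin.snoc_injective_iff]
        refine ⟨hvm.injective.comp (Fin.castSucc_injective N), ?_⟩
        rintro ⟨q, hq⟩
        have := hvm (Fin.castSucc_lt_last q)
        simp only at hq
        linarith
      have hsub : Finset.univ.image (Fin.snoc (fun q => v q.castSucc) y : Fin (N + 1) → ℝ) ⊆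
          (P.roots.filter (0 < ·)).toFinset := by
        intro t ht
        obtain ⟨j, -, rfl⟩ := Finset.mem_image.1 ht
        rw [Multiset.mem_toFinset, Multiset.mem_filter, mem_roots hP0]
        induction j using Fin.lastCases with
        | last => simpa using ⟨hy, (hv _).trans_le hle⟩
        | cast q => simpa using ⟨hroot q, hv _⟩
      have h1 := Finset.card_le_card hsub
      rw [Finset.card_image_of_injective _ hinj, Finset.card_univ, Fintype.card_fin] at h1
      have h2 := Multiset.toFinset_card_le (P.roots.filter (0 < ·))
      rw [← Multiset.countP_eq_card_filter] at h2
      have h3 := P.roots_countP_pos_le_signVariations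
      have h4 := signVariations_lt_card_support hP0
      omega
    rw [heval] at key
    convert key using 5 with i j
    induction j using Fin.lastCases with
    | last => simp
    | cast q => simp

/-- `det_generalizedVandermonde_pos` over an arbitrary finite linear order. -/
theorem det_generalizedVandermonde_pos' {ι : Type*} [Fintype ι] [LinearOrder ι]
    (v : ι → ℝ) (hv : ∀ j, 0 < v j) (hvm : StrictMono v) (ν : ι → ℕ) (hν : StrictMono ν) :
    0 < (Matrix.of fun i j => v j ^ ν i).det := by
  let e := Fintype.orderIsoFinOfCardEq ι rfl
  have := det_generalizedVandermonde_pos _ (v ∘ e) (fun j => hv _) (hvm.comp e.strictMono)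
    (ν ∘ e) (hν.comp e.strictMono)
  rw [← Matrix.det_submatrix_equiv_self e.toEquiv]
  exact this

open Asymptotics Filter Topology in
/-- The determinant is locally Lipschitz: perturbing every entry by `O(h)` perturbs it by `O(h)`. -/
theorem Matrix.det_sub_det_isBigO {ι α : Type*} [Fintype ι] [DecidableEq ι] {l : Filter α}
    {h : α → ℝ} (hh : Tendsto h l (𝓝 0)) (A : α → Matrix ι ι ℝ) (L : Matrix ι ι ℝ)
    (hA : ∀ i j, (fun t => A t i j - L i j) =O[l] h) :
    (fun t => (A t).det - L.det) =O[l] h := by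
  have hmul : ∀ (s : Finset ι) (σ : Equiv.Perm ι),
      (fun t => ∏ i ∈ s, A t (σ i) i - ∏ i ∈ s, L (σ i) i) =O[l] h := by
    intro s σ
    induction s using Finset.induction_on with
    | empty => simpa using isBigO_zero h l
    | insert i s hi ih =>
      simp only [Finset.prod_insert hi]
      have hbdd : (fun t => A t (σ i) i) =O[l] (fun _ => (1 : ℝ)) := by
        have h1 := ((hA (σ i) i).trans (hh.isBigO_one ℝ)).add
          (isBigO_const_const (L (σ i) i) (one_ne_zero (α := ℝ)) l)
        simpa using h1
      have h2 := hbdd.mul ih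
      have h3 := (hA (σ i) i).mul
        (isBigO_const_const (∏ i ∈ s, L (σ i) i) (one_ne_zero (α := ℝ)) l)
      simp only [one_mul, mul_one] at h2 h3
      refine (h2.add h3).congr_left fun t => ?_
      ring
  simp only [Matrix.det_apply, ← Finset.sum_sub_distrib, ← smul_sub]
  refine IsBigO.fun_sum fun σ _ => ?_
  simp only [Units.smul_def, zsmul_eq_mul]
  exact (hmul _ σ).const_mul_left _

open Asymptotics Filter Topology in
/-- Leading asymptotics of the determinant of a matrix of real monomials in `t`, when the row and
column potentials `a`, `b` make the lowest-order part block triangular. -/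
theorem det_monomial_asymptotics {ι κ : Type*} [Fintype ι] [LinearOrder ι] [Fintype κ]
    [LinearOrder κ] (g : ι → κ) (A : ℝ → Matrix ι ι ℝ) (w o : ι → ι → ℝ) (a b : ι → ℝ)
    (hA : ∀ t, 0 < t → ∀ i j, A t i j = w i j * t ^ o i j)
    (hge : ∀ i j, w i j = 0 ∨ o i j = a i + b j ∨ a i + b j + 1 ≤ o i j)
    (htri : ∀ i j, g j < g i → w i j = 0 ∨ a i + b j + 1 ≤ o i j)
    (hdiag : ∀ i j, g i = g j → o i j = a i + b j)
    (hpos : ∀ k, 0 < ((Matrix.of w).toSquareBlock g k).det) :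
    ∃ C : ℝ, 0 < C ∧ (fun t => (A t).det - C * t ^ (∑ i, a i + ∑ i, b i))
      =O[𝓝[>] (0 : ℝ)] fun t => t ^ (∑ i, a i + ∑ i, b i + 1) := by
  set L : Matrix ι ι ℝ := Matrix.of fun i j => if o i j = a i + b j then w i j else 0 with hL
  set B : ℝ → Matrix ι ι ℝ := fun t => Matrix.of fun i j => w i j * t ^ (o i j - a i - b j) with hB
  have hLtri : L.BlockTriangular g := by
    intro i j hij
    simp only [hL, Matrix.of_apply, ite_eq_right_iff]
    intro h
    rcases htri i j hij with h' | h'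
    · exact h'
    · linarith
  have hLpos : 0 < L.det := by
    rw [hLtri.det_fintype]
    refine Finset.prod_pos fun k _ => ?_
    suffices h : L.toSquareBlock g k = (Matrix.of w).toSquareBlock g k by
      rw [h]
      exact hpos k
    ext ⟨i, hi⟩ ⟨j, hj⟩
    simp [hL, Matrix.toSquareBlock_def, hdiag i j (hi.trans hj.symm)]
  have hid : Tendsto (fun t : ℝ => t) (𝓝[>] 0) (𝓝 0) := tendsto_id.mono_left nhdsWithin_le_nhds
  have hBL : (fun t => (B t).det - L.det) =O[𝓝[>] (0 : ℝ)] fun t => t := by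
    refine Matrix.det_sub_det_isBigO hid B L fun i j => ?_
    simp only [hB, hL, Matrix.of_apply]
    by_cases h : o i j = a i + b j
    · simpa [h] using isBigO_zero _ _
    · simp only [if_neg h, sub_zero]
      rcases hge i j with h' | h' | h'
      · simpa [h'] using isBigO_zero _ _
      · exact absurd h' h
      · refine IsBigO.const_mul_left (IsBigO.of_bound 1 ?_) _
        filter_upwards [Ioo_mem_nhdsGT (zero_lt_one' ℝ)] with t ht
        rw [Real.norm_of_nonneg (Real.rpow_nonneg ht.1.le _), Real.norm_of_nonneg ht.1.le, one_mul]
        calc t ^ (o i j - a i - b j) ≤ t ^ (1 : ℝ) :=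
              Real.rpow_le_rpow_of_exponent_ge ht.1 ht.2.le (by linarith)
          _ = t := Real.rpow_one t
  refine ⟨L.det, hLpos, ?_⟩
  have hdet : ∀ t, 0 < t → (A t).det = t ^ (∑ i, a i + ∑ i, b i) * (B t).det := by
    intro t ht
    have h1 := Matrix.det_mul_row (fun j => t ^ b j) (B t)
    have h2 := Matrix.det_mul_column (fun i => t ^ a i)
      (Matrix.of fun i j => t ^ b j * B t i j)
    rw [h1, ← mul_assoc, ← Real.rpow_sum_of_pos ht, ← Real.rpow_sum_of_pos ht,
      ← Real.rpow_add ht] at h2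
    rw [← h2]
    congr 1
    ext i j
    simp only [hA t ht, hB, Matrix.of_apply]
    rw [mul_left_comm (t ^ b j), mul_left_comm (t ^ a i), ← Real.rpow_add ht, ← Real.rpow_add ht]
    congr 2
    ring
  have h3 := (isBigO_refl (fun t : ℝ => t ^ (∑ i, a i + ∑ i, b i)) (𝓝[>] 0)).mul hBL
  refine h3.congr' ?_ ?_
  · filter_upwards [self_mem_nhdsWithin] with t ht
    rw [hdet t ht]
    ring
  · filter_upwards [self_mem_nhdsWithin] with t ht
    rw [Real.rpow_add_one (ne_of_gt ht)]

/-- Rotation of the segment `[a, b)` of `Fin N` by `d` places. -/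
theorem exists_perm_rotate_segment (N a b d : ℕ) (hab : a + d ≤ b) (hb : b ≤ N) :
    ∃ q : Equiv.Perm (Fin N), ∀ i : Fin N, (q i : ℕ) =
      if (i : ℕ) < a ∨ b ≤ i then (i : ℕ) else if (i : ℕ) + d < b then i + d else i + d + a - b := by
  let f : Fin N → Fin N := fun i =>
    ⟨if (i : ℕ) < a ∨ b ≤ i then (i : ℕ) else if (i : ℕ) + d < b then i + d else i + d + a - b, by
      have := i.isLt
      split_ifs <;> omega⟩
  have hf : Function.Injective f := by
    intro i j hij
    have h := congrArg Fin.val hij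
    simp only [f] at h
    ext
    split_ifs at h <;> omega
  exact ⟨Equiv.ofBijective f (Finite.injective_iff_bijective.1 hf), fun i => rfl⟩

/-- The `4`-cycle `1 ↦ 3 ↦ 4 ↦ 2 ↦ 1` on `Fin N` is odd. -/
theorem exists_perm_four_cycle (N : ℕ) (hN : 5 ≤ N) :
    ∃ s : Equiv.Perm (Fin N), Equiv.Perm.sign s = -1 ∧ ∀ i : Fin N, (s i : ℕ) =
      if (i : ℕ) = 1 then 3 else if (i : ℕ) = 2 then 1 else if (i : ℕ) = 3 then 4
      else if (i : ℕ) = 4 then 2 else (i : ℕ) := by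
  have hex : ∀ j < 5, ∃ i : Fin N, (i : ℕ) = j := fun j hj => ⟨⟨j, by omega⟩, rfl⟩
  obtain ⟨e₁, h₁⟩ := hex 1 (by omega)
  obtain ⟨e₂, h₂⟩ := hex 2 (by omega)
  obtain ⟨e₃, h₃⟩ := hex 3 (by omega)
  obtain ⟨e₄, h₄⟩ := hex 4 (by omega)
  refine ⟨Equiv.swap e₁ e₂ * Equiv.swap e₁ e₄ * Equiv.swap e₁ e₃, ?_, fun i => ?_⟩
  · have h12 : e₁ ≠ e₂ := fun h => by simp [h, h₂] at h₁
    have h14 : e₁ ≠ e₄ := fun h => by simp [h, h₄] at h₁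
    have h13 : e₁ ≠ e₃ := fun h => by simp [h, h₃] at h₁
    simp [Equiv.Perm.sign_swap h12, Equiv.Perm.sign_swap h14, Equiv.Perm.sign_swap h13]
  · have hval : ∀ a b c : Fin N, (Equiv.swap a b c : ℕ) =
        if (c : ℕ) = a then (b : ℕ) else if (c : ℕ) = b then (a : ℕ) else c := fun a b c => by
      rw [Equiv.swap_apply_def]
      simp only [Fin.ext_iff]
      split_ifs <;> rfl
    change ((Equiv.swap e₁ e₂ (Equiv.swap e₁ e₄ (Equiv.swap e₁ e₃ i)) : Fin N) : ℕ) = _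
    have hi := hval e₁ e₃ i
    generalize Equiv.swap e₁ e₃ i = j at hi
    have hj := hval e₁ e₄ j
    generalize Equiv.swap e₁ e₄ j = l at hj
    have hl := hval e₁ e₂ l
    rw [h₁, h₃] at hi
    rw [h₁, h₄] at hj
    rw [h₁, h₂] at hl
    rw [hl]
    split_ifs at hi hj ⊢ <;> omega

/-- The (1-based) row paired with the (0-based) column `c` in the leading term of `det ℰ(τ)`. -/
def leadingRow (n m c : ℕ) : ℕ :=
  if c = 0 then 1 else if c = 1 then 4 else if c < n then c + 5
  else if c = n then 2 else if c = n + 1 then 5 else if c < n + m then c + 3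
  else if c = n + m then 3 else if c = n + m + 1 then 6 else c + 1

theorem exists_perm_leadingRow (n m k : ℕ) (hn : 2 ≤ n) (hm : 2 ≤ m) (hk : 2 ≤ k) :
    ∃ p : Equiv.Perm (Fin (n + m + k)), Equiv.Perm.sign p = -1 ∧
      ∀ c, (p c : ℕ) + 1 = leadingRow n m c := by
  obtain ⟨q₁, hq₁⟩ := exists_perm_rotate_segment (n + m + k) 2 (n + 4) 2 (by omega) (by omega)
  obtain ⟨q₂, hq₂⟩ := exists_perm_rotate_segment (n + m + k) (n + 2) (n + m + 2) 1
    (by omega) (by omega)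
  obtain ⟨s, hsign, hs⟩ := exists_perm_four_cycle (n + m + k) (by omega)
  refine ⟨s * (q₁ * q₁) * (q₂ * q₂), ?_, fun c => ?_⟩
  · simp [hsign]
  · have hc := c.isLt
    change ((s (q₁ (q₁ (q₂ (q₂ c)))) : Fin (n + m + k)) : ℕ) + 1 = _
    have h1 : (q₂ (q₂ c) : ℕ) = if (c : ℕ) < n + 2 ∨ n + m + 2 ≤ c then (c : ℕ)
        else if (c : ℕ) < n + m then c + 2 else c + 2 - m := by
      rw [hq₂, hq₂]
      split_ifs <;> omega
    generalize q₂ (q₂ c) = d at h1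
    have h2 : (q₁ (q₁ d) : ℕ) = if (d : ℕ) < 2 ∨ n + 4 ≤ d then (d : ℕ)
        else if (d : ℕ) < n then d + 4 else d + 2 - n := by
      rw [hq₁, hq₁]
      split_ifs <;> omega
    generalize q₁ (q₁ d) = f at h2
    have h3 : (f : ℕ) = if (c : ℕ) < 2 then (c : ℕ) else if (c : ℕ) < n then c + 4
        else if (c : ℕ) < n + 2 then c + 2 - n else if (c : ℕ) < n + m then c + 2
        else if (c : ℕ) < n + m + 2 then c + 4 - n - m else c := by
      clear hq₁ hq₂ hs
      split_ifs at h1 <;> rw [h2, h1] <;> split_ifs <;> omega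
    clear hq₁ hq₂ h1 h2
    rw [hs, leadingRow]
    clear hs
    grind (splits := 20)

/-- The group (`0` for `x`, `1` for `y`, `2` for `z`) of the column `c`. -/
def columnGroup (n m c : ℕ) : Fin 3 := if c < n then 0 else if c < n + m then 1 else 2

theorem columnGroup_leadingRow_cases (n m k : ℕ) (hn : 2 ≤ n) (hm : 2 ≤ m) (c : ℕ)
    (hc : c < n + m + k) :
    (columnGroup n m c = 0 ∧ c < n ∧
      (leadingRow n m c = 1 ∨ leadingRow n m c = 4 ∨
        (7 ≤ leadingRow n m c ∧ leadingRow n m c ≤ n + 4))) ∨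
    (columnGroup n m c = 1 ∧ (n ≤ c ∧ c < n + m) ∧
      (leadingRow n m c = 2 ∨ leadingRow n m c = 5 ∨
        (n + 5 ≤ leadingRow n m c ∧ 7 ≤ leadingRow n m c ∧ leadingRow n m c ≤ n + m + 2))) ∨
    (columnGroup n m c = 2 ∧ n + m ≤ c ∧
      (leadingRow n m c = 3 ∨ leadingRow n m c = 6 ∨
        (n + m + 3 ≤ leadingRow n m c ∧ 7 ≤ leadingRow n m c ∧
          leadingRow n m c ≤ n + m + k))) := by
  rw [columnGroup, leadingRow]
  split_ifs <;> simp <;> omega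

theorem leadingRow_lt_of_columnGroup_eq (n m : ℕ) (hn : 2 ≤ n) (hm : 2 ≤ m) (c d : ℕ) (hcd : c < d)
    (hg : columnGroup n m c = columnGroup n m d) :
    leadingRow n m c < leadingRow n m d ∧ 4 ≤ leadingRow n m d := by
  rw [columnGroup, columnGroup] at hg
  rw [leadingRow, leadingRow]
  split_ifs at hg <;> simp at hg <;> split_ifs <;> omega

theorem leadingRow_eq_add_five {n c : ℕ} (m : ℕ) (h : 2 ≤ c) (hc : c < n) :
    leadingRow n m c = c + 5 := by
  rw [leadingRow, if_neg (by omega), if_neg (by omega), if_pos hc]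

theorem leadingRow_eq_add_three {n m c : ℕ} (hn : 2 ≤ n) (h : n + 2 ≤ c) (hc : c < n + m) :
    leadingRow n m c = c + 3 := by
  rw [leadingRow, if_neg (by omega), if_neg (by omega), if_neg (by omega), if_neg (by omega),
    if_neg (by omega), if_pos hc]

theorem leadingRow_self {n : ℕ} (m : ℕ) (hn : 2 ≤ n) : leadingRow n m n = 2 := by
  rw [leadingRow, if_neg (by omega), if_neg (by omega), if_neg (by omega), if_pos rfl]

theorem leadingRow_self_add_one {n : ℕ} (m : ℕ) (hn : 2 ≤ n) : leadingRow n m (n + 1) = 5 := by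
  rw [leadingRow, if_neg (by omega), if_neg (by omega), if_neg (by omega), if_neg (by omega),
    if_pos rfl]

theorem columnGroup_eq_zero {n c : ℕ} (m : ℕ) (h : c < n) : columnGroup n m c = 0 := if_pos h

theorem columnGroup_eq_one {n m c : ℕ} (h : n ≤ c) (h' : c < n + m) : columnGroup n m c = 1 :=
  (if_neg h.not_gt).trans (if_pos h')

theorem columnGroup_eq_two {n m c : ℕ} (h : n + m ≤ c) : columnGroup n m c = 2 :=
  (if_neg (by omega)).trans (if_neg h.not_gt)

/-- The power of `τ` scaling the columns of a group. -/
def groupScale (i : Fin 3) : ℝ := if i = 0 then 2 else if i = 1 then 1 else 0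

theorem groupScale_zero : groupScale 0 = 2 := if_pos rfl

theorem groupScale_one : groupScale 1 = 1 := (if_neg (by decide)).trans (if_pos rfl)

theorem groupScale_two : groupScale 2 = 0 := (if_neg (by decide)).trans (if_neg (by decide))

theorem sum_groupScale_mul_leadingRow (n m k : ℕ) (hn : 2 ≤ n) (hm : 2 ≤ m) (μ : ℕ → ℕ) :
    ∑ c : Fin (n + m + k), groupScale (columnGroup n m c) * (μ (leadingRow n m c) : ℝ) =
      xi19 n m μ := by
  rw [Fin.sum_univ_eq_sum_range
    (fun c => groupScale (columnGroup n m c) * (μ (leadingRow n m c) : ℝ)), Finset.sum_range_add,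
    Finset.sum_range_add]
  have hx : ∑ c ∈ Finset.range n, groupScale (columnGroup n m c) * (μ (leadingRow n m c) : ℝ) =
      2 * ((μ 1 : ℝ) + (μ 4 : ℝ) + ∑ i ∈ Finset.Icc 7 (n + 4), (μ i : ℝ)) := by
    rw [Finset.sum_congr rfl fun c hc => by
      rw [columnGroup_eq_zero m (Finset.mem_range.1 hc), groupScale_zero], ← Finset.mul_sum]
    obtain ⟨n, rfl⟩ := Nat.exists_eq_add_of_le' hn
    rw [Finset.sum_range_succ', Finset.sum_range_succ', ← Finset.Ico_add_one_right_eq_Icc,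
      Finset.sum_Ico_eq_sum_range, show n + 2 + 4 + 1 - 7 = n by omega,
      Finset.sum_congr rfl fun c hc => by
        rw [leadingRow_eq_add_five m (by omega) (by have := Finset.mem_range.1 hc; omega),
          show c + 1 + 1 + 5 = 7 + c by omega],
      show leadingRow (n + 2) m 0 = 1 from rfl, show leadingRow (n + 2) m (0 + 1) = 4 from rfl]
    ring
  have hy : ∑ c ∈ Finset.range m, groupScale (columnGroup n m (n + c)) *
      (μ (leadingRow n m (n + c)) : ℝ) =
      (μ 2 : ℝ) + (μ 5 : ℝ) + ∑ i ∈ Finset.Icc (n + 5) (n + m + 2), (μ i : ℝ) := by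
    rw [Finset.sum_congr rfl fun c hc => by
      rw [columnGroup_eq_one (by omega) (by have := Finset.mem_range.1 hc; omega), groupScale_one,
        one_mul]]
    obtain ⟨m, rfl⟩ := Nat.exists_eq_add_of_le' hm
    rw [Finset.sum_range_succ', Finset.sum_range_succ', ← Finset.Ico_add_one_right_eq_Icc,
      Finset.sum_Ico_eq_sum_range, show n + (m + 2) + 2 + 1 - (n + 5) = m by omega,
      Finset.sum_congr rfl fun c hc => by
        rw [leadingRow_eq_add_three hn (by omega) (by have := Finset.mem_range.1 hc; omega),
          show n + (c + 1 + 1) + 3 = n + 5 + c by omega],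
      add_zero, zero_add, leadingRow_self _ hn, leadingRow_self_add_one _ hn]
    ring
  have hz : ∑ c ∈ Finset.range k, groupScale (columnGroup n m (n + m + c)) *
      (μ (leadingRow n m (n + m + c)) : ℝ) = 0 :=
    Finset.sum_eq_zero fun c _ => by
      rw [columnGroup_eq_two (by omega), groupScale_two, zero_mul]
  rw [hx, hy, hz, xi19]
  ring

theorem ite_zero_mul_rpow_add_ite {P Q : Prop} [Decidable P] [Decidable Q] {t : ℝ} (ht : 0 < t)
    (u s M : ℝ) :
    (if P then 0 else u) * t ^ (s + if Q then M else 0) =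
      if P then 0 else if Q then t ^ M * (u * t ^ s) else u * t ^ s := by
  split_ifs
  · simp
  · simp
  · rw [Real.rpow_add ht]
    ring
  · rw [add_zero]

/-- Lemma `lem:det3`. Asymptotic expansion
`E(τ) = C' τ^ξ + Θ(τ^{ξ+1})` (as `τ → 0⁺`) of `E(τ) = - det ℰ(τ)`, with a positive
leading coefficient `C'` independent of `τ`. -/
theorem det_asymptotics_three_groups
    (n m k : ℕ) (hn : 2 ≤ n) (hm : 2 ≤ m) (hk : 2 ≤ k) (hnmk : 7 ≤ n + m + k)
    (x : Fin n → ℝ) (y : Fin m → ℝ) (z : Fin k → ℝ)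
    (hxpos : ∀ j, 0 < x j) (hxmono : StrictMono x)
    (hypos : ∀ j, 0 < y j) (hymono : StrictMono y)
    (hzpos : ∀ j, 0 < z j) (hzmono : StrictMono z)
    (μ : ℕ → ℕ) (hμ12 : μ 1 ≤ μ 2) (hμ23 : μ 2 ≤ μ 3)
    (hμmono : ∀ i j : ℕ, 3 ≤ i → i < j → j ≤ n + m + k → μ i < μ j)
    (M : ℝ) (hM : 2 * ∑ i ∈ Finset.Icc 1 (n + m + k), (μ i : ℝ) ≤ M) :
    ∃ C' : ℝ, 0 < C' ∧ ∃ c : ℝ, 0 ≤ c ∧ ∃ τ₀ : ℝ, 0 < τ₀ ∧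
      ∀ τ : ℝ, 0 < τ → τ < τ₀ →
        |-(mat19 n m k x y z μ M τ).det - C' * τ ^ xi19 n m μ| ≤
          c * τ ^ (xi19 n m μ + 1) := by
  obtain ⟨p, hpsign, hp⟩ := exists_perm_leadingRow n m k hn hm hk
  set R : ℕ → ℕ := leadingRow n m with hR
  set G : ℕ → Fin 3 := columnGroup n m with hG
  have hcases := columnGroup_leadingRow_cases n m k hn hm
  simp only [← hR, ← hG] at hcases
  let v : Fin (n + m + k) → ℝ := fun c =>
    if hc : (c : ℕ) < n then x ⟨c, hc⟩
    else if hc' : (c : ℕ) < n + m then y ⟨(c : ℕ) - n, by omega⟩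
    else z ⟨(c : ℕ) - n - m, by have := c.isLt; omega⟩
  have hv : ∀ c, 0 < v c := by
    intro c
    simp only [v]
    split_ifs
    exacts [hxpos _, hypos _, hzpos _]
  have hvmono : ∀ c d : Fin (n + m + k), c < d → G c = G d → v c < v d := by
    intro c d hcd hg
    have hlt : (c : ℕ) < d := hcd
    rcases hcases c c.isLt with ⟨h1, h2, -⟩ | ⟨h1, h2, -⟩ | ⟨h1, h2, -⟩ <;>
    rcases hcases d d.isLt with ⟨h3, h4, -⟩ | ⟨h3, h4, -⟩ | ⟨h3, h4, -⟩ <;>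
    simp only [h1, h3, Fin.reduceEq] at hg
    · simp only [v, dif_pos h2, dif_pos h4]
      exact hxmono hlt
    · simp only [v, dif_neg h2.1.not_gt, dif_neg h4.1.not_gt, dif_pos h2.2, dif_pos h4.2]
      exact hymono (by simp only [Fin.mk_lt_mk]; omega)
    · have h5 : ¬ (c : ℕ) < n := by omega
      have h6 : ¬ (d : ℕ) < n := by omega
      simp only [v, dif_neg h5, dif_neg h6, dif_neg h2.not_gt, dif_neg h4.not_gt]
      exact hzmono (by simp only [Fin.mk_lt_mk]; omega)
  have hνmono : ∀ c d : Fin (n + m + k), c < d → G c = G d → μ (R c) < μ (R d) := by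
    intro c d hcd hg
    obtain ⟨h1, h2⟩ := leadingRow_lt_of_columnGroup_eq n m hn hm c d hcd hg
    have h3 : R d ≤ n + m + k := by
      have := hp d
      have := (p d).isLt
      omega
    rcases le_or_gt 3 (R c) with h | h
    · exact hμmono _ _ h h1 h3
    · have h4 := hμmono 3 (R d) le_rfl h2 h3
      have h5 : 1 ≤ R c := by
        have := hp c
        omega
      have h6 : R c = 1 ∨ R c = 2 := by omega
      rcases h6 with h6 | h6 <;> rw [h6] <;> omega
  let w : Fin (n + m + k) → Fin (n + m + k) → ℝ := fun c d =>
    if (R c = 1 ∧ G d ≠ 0) ∨ (R c = 2 ∧ G d ≠ 1) ∨ (R c = 3 ∧ G d ≠ 2) then 0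
    else v d ^ μ (R c)
  let o : Fin (n + m + k) → Fin (n + m + k) → ℝ := fun c d =>
    groupScale (G d) * μ (R c) +
      if (R c = 4 ∧ G d ≠ 0) ∨ (R c = 5 ∧ G d ≠ 1) ∨ (R c = 6 ∧ G d ≠ 2) then M else 0
  let b : Fin (n + m + k) → ℝ := fun d =>
    if G d = 0 then 0 else if G d = 1 then -(μ (n + 4) : ℝ)
    else -(μ (n + 4) : ℝ) - μ (n + m + 2)
  let a : Fin (n + m + k) → ℝ := fun c => groupScale (G c) * μ (R c) - b c
  have hsum : ∑ i, a i + ∑ i, b i = xi19 n m μ := by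
    rw [← sum_groupScale_mul_leadingRow n m k hn hm μ, ← Finset.sum_add_distrib]
    simp [a, hG, hR]
  have hmono : ∀ i j : ℕ, 3 ≤ i → i < j → j ≤ n + m + k → (μ i : ℝ) + 1 ≤ μ j :=
    fun i j h1 h2 h3 => by exact_mod_cast hμmono i j h1 h2 h3
  have hmono' : ∀ i j : ℕ, 3 ≤ i → i ≤ j → j ≤ n + m + k → (μ i : ℝ) ≤ μ j :=
    fun i j h1 h2 h3 => by
      rcases h2.eq_or_lt with rfl | h2
      · exact le_rfl
      · linarith [hmono i j h1 h2 h3]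
  have h3 : (0 : ℝ) ≤ μ 3 := Nat.cast_nonneg _
  have h34 := hmono 3 4 le_rfl (by omega) (by omega)
  have h45 := hmono 4 5 (by omega) (by omega) (by omega)
  have h56 := hmono 5 6 (by omega) (by omega) (by omega)
  have h6θ := hmono' 6 (n + 4) (by omega) (by omega) (by omega)
  have hθθ := hmono' (n + 4) (n + m + 2) (by omega) (by omega) (by omega)
  have hMθ : 2 * (μ (n + m + 2) : ℝ) ≤ M := by
    have := Finset.single_le_sum (f := fun i => (μ i : ℝ)) (s := Finset.Icc 1 (n + m + k))
      (fun i _ => Nat.cast_nonneg _) (Finset.mem_Icc.2 ⟨by omega, by omega⟩ :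
        n + m + 2 ∈ Finset.Icc 1 (n + m + k))
    linarith
  have hdiag : ∀ c d : Fin (n + m + k), G c = G d → o c d = a c + b d ∧ w c d = v d ^ μ (R c) := by
    intro c d hg
    have hb : b c = b d := by simp only [b, hg]
    have hM' : ¬ ((R c = 4 ∧ G d ≠ 0) ∨ (R c = 5 ∧ G d ≠ 1) ∨ (R c = 6 ∧ G d ≠ 2)) := by
      rw [← hg]
      rcases hcases c c.isLt with ⟨h1, -, h2⟩ | ⟨h1, -, h2⟩ | ⟨h1, -, h2⟩ <;> rw [h1] <;> omega
    have hw' : ¬ ((R c = 1 ∧ G d ≠ 0) ∨ (R c = 2 ∧ G d ≠ 1) ∨ (R c = 3 ∧ G d ≠ 2)) := by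
      rw [← hg]
      rcases hcases c c.isLt with ⟨h1, -, h2⟩ | ⟨h1, -, h2⟩ | ⟨h1, -, h2⟩ <;> rw [h1] <;> omega
    refine ⟨?_, if_neg hw'⟩
    simp only [o, a]
    rw [if_neg hM', hg, hb]
    ring
  have hoff : ∀ c d : Fin (n + m + k), G c ≠ G d →
      w c d = 0 ∨ a c + b d + 1 ≤ o c d ∨ (G c < G d ∧ o c d = a c + b d) := by
    have hbx : ∀ d : Fin (n + m + k), G d = 0 → b d = 0 := fun d h => by simp [b, h]
    have hby : ∀ d : Fin (n + m + k), G d = 1 → b d = -(μ (n + 4) : ℝ) := fun d h => by simp [b, h]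
    have hbz : ∀ d : Fin (n + m + k), G d = 2 → b d = -(μ (n + 4) : ℝ) - μ (n + m + 2) :=
      fun d h => by simp [b, h]
    have ha : ∀ c : Fin (n + m + k), a c = groupScale (G c) * μ (R c) - b c := fun c => rfl
    have hoM : ∀ c d : Fin (n + m + k),
        ((R c = 4 ∧ G d ≠ 0) ∨ (R c = 5 ∧ G d ≠ 1) ∨ (R c = 6 ∧ G d ≠ 2)) →
        o c d = groupScale (G d) * μ (R c) + M := fun c d h => by simp only [o, if_pos h]
    have ho : ∀ c d : Fin (n + m + k), 7 ≤ R c → o c d = groupScale (G d) * μ (R c) := fun c d h => by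
      simp only [o]
      rw [if_neg (by omega), add_zero]
    intro c d hg
    rcases hcases c c.isLt with ⟨h1, -, h2⟩ | ⟨h1, -, h2⟩ | ⟨h1, -, h2⟩
    · have hd : G d = 1 ∨ G d = 2 := by omega
      rcases h2 with h2 | h2 | ⟨h7, h2⟩
      · exact Or.inl (if_pos (Or.inl ⟨h2, h1 ▸ hg.symm⟩))
      · refine Or.inr (Or.inl ?_)
        rw [hoM c d (Or.inl ⟨h2, h1 ▸ hg.symm⟩), ha, hbx c h1, h1, h2]
        rcases hd with hd | hd
        · rw [hd, hby d hd, groupScale_zero, groupScale_one]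
          linarith
        · rw [hd, hbz d hd, groupScale_zero, groupScale_two]
          linarith
      · right
        have hle := hmono' (R c) (n + 4) (by omega) h2 (by omega)
        rw [ho c d h7, ha, hbx c h1, h1]
        rcases hd with hd | hd
        · rw [hd, hby d hd, groupScale_zero, groupScale_one]
          rcases h2.eq_or_lt with h | h
          · exact Or.inr ⟨by decide, by rw [h]; ring⟩
          · left
            linarith [hmono _ _ (by omega) h (by omega)]
        · rw [hd, hbz d hd, groupScale_zero, groupScale_two]
          rcases h2.eq_or_lt with h | h
          · rcases (show n + 4 ≤ n + m + 2 by omega).eq_or_lt with h' | h'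
            · exact Or.inr ⟨by decide, by rw [h, ← h']; ring⟩
            · left
              linarith [hmono _ _ (by omega) h' (by omega)]
          · left
            linarith [hmono _ _ (by omega) h (by omega)]
    · have hd : G d = 0 ∨ G d = 2 := by omega
      rcases h2 with h2 | h2 | ⟨h5, h7, h2⟩
      · exact Or.inl (if_pos (Or.inr (Or.inl ⟨h2, h1 ▸ hg.symm⟩)))
      · refine Or.inr (Or.inl ?_)
        rw [hoM c d (Or.inr (Or.inl ⟨h2, h1 ▸ hg.symm⟩)), ha, hby c h1, h1, h2]
        rcases hd with hd | hd
        · rw [hd, hbx d hd, groupScale_zero, groupScale_one]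
          linarith
        · rw [hd, hbz d hd, groupScale_one, groupScale_two]
          linarith
      · right
        rw [ho c d h7, ha, hby c h1, h1]
        rcases hd with hd | hd
        · rw [hd, hbx d hd, groupScale_zero, groupScale_one]
          left
          linarith [hmono (n + 4) (R c) (by omega) (by omega) (by omega)]
        · rw [hd, hbz d hd, groupScale_one, groupScale_two]
          rcases h2.eq_or_lt with h | h
          · exact Or.inr ⟨by decide, by rw [h]; ring⟩
          · left
            linarith [hmono _ _ (by omega) h (by omega)]
    · have hd : G d = 0 ∨ G d = 1 := by omega
      rcases h2 with h2 | h2 | ⟨h5, h7, h2⟩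
      · exact Or.inl (if_pos (Or.inr (Or.inr ⟨h2, h1 ▸ hg.symm⟩)))
      · refine Or.inr (Or.inl ?_)
        rw [hoM c d (Or.inr (Or.inr ⟨h2, h1 ▸ hg.symm⟩)), ha, hbz c h1, h1, h2]
        rcases hd with hd | hd
        · rw [hd, hbx d hd, groupScale_zero, groupScale_two]
          linarith
        · rw [hd, hby d hd, groupScale_one, groupScale_two]
          linarith
      · refine Or.inr (Or.inl ?_)
        have := hmono (n + m + 2) (R c) (by omega) (by omega) h2
        rw [ho c d h7, ha, hbz c h1, h1]
        rcases hd with hd | hd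
        · rw [hd, hbx d hd, groupScale_zero, groupScale_two]
          linarith
        · rw [hd, hby d hd, groupScale_one, groupScale_two]
          linarith
  have hasymp := det_monomial_asymptotics (fun c : Fin (n + m + k) => G c)
    (fun t => (mat19 n m k x y z μ M t).submatrix p id) w o a b ?_ ?_ ?_
    (fun c d h => (hdiag c d h).1) ?_
  · obtain ⟨C, hC, hO⟩ := hasymp
    rw [hsum] at hO
    obtain ⟨K, hK, hbound⟩ := hO.exists_nonneg
    rw [Asymptotics.isBigOWith_iff] at hbound
    obtain ⟨τ₀, hτ₀, hsub⟩ := mem_nhdsGT_iff_exists_Ioo_subset.1 hbound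
    refine ⟨C, hC, K, hK, τ₀, hτ₀, fun τ h1 h2 => ?_⟩
    have h := hsub ⟨h1, h2⟩
    simp only [Set.mem_ofPred_eq, Matrix.det_permute, hpsign] at h
    rw [Real.norm_eq_abs, Real.norm_of_nonneg (Real.rpow_nonneg h1.le _)] at h
    simpa using h
  · intro t ht c d
    have hpc := hp c
    simp only [Matrix.submatrix_apply, id_eq, mat19, Matrix.of_apply, hpc, w, o]
    rw [ite_zero_mul_rpow_add_ite ht]
    have hp2 : ∀ (r : ℝ) (e : ℕ), (r * t ^ 2) ^ e = r ^ e * t ^ (2 * (e : ℝ)) := fun r e => by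
      rw [mul_pow, ← pow_mul, ← Real.rpow_natCast t (2 * e)]
      push_cast
      rfl
    have hp1 : ∀ (r : ℝ) (e : ℕ), (r * t) ^ e = r ^ e * t ^ (e : ℝ) := fun r e => by
      rw [mul_pow, Real.rpow_natCast]
    by_cases hd : (d : ℕ) < n
    · have hGd : G d = 0 := columnGroup_eq_zero m hd
      simp [hGd, hd, v, hp2, groupScale_zero]
    · by_cases hd' : (d : ℕ) < n + m
      · have hGd : G d = 1 := columnGroup_eq_one (not_lt.1 hd) hd'
        simp [hGd, hd, hd', v, hp1, groupScale_one]
      · have hGd : G d = 2 := columnGroup_eq_two (not_lt.1 hd')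
        simp [hGd, hd, hd', v, groupScale_two]
  · intro c d
    by_cases h : G c = G d
    · exact Or.inr (Or.inl (hdiag c d h).1)
    · rcases hoff c d h with h | h | h
      exacts [Or.inl h, Or.inr (Or.inr h), Or.inr (Or.inl h.2)]
  · intro c d h
    rcases hoff c d h.ne' with h' | h' | h'
    exacts [Or.inl h', Or.inr h', absurd h'.1 h.not_gt]
  · intro i
    suffices h : (Matrix.of w).toSquareBlock (fun c : Fin (n + m + k) => G c) i =
        Matrix.of fun c d : { c : Fin (n + m + k) // G c = i } => v d ^ μ (R c) by
      rw [h]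
      exact det_generalizedVandermonde_pos' (fun d : { c : Fin (n + m + k) // G c = i } => v d)
        (fun d => hv d) (fun c d hcd => hvmono c d hcd (c.2.trans d.2.symm))
        (fun c => μ (R c)) (fun c d hcd => hνmono c d hcd (c.2.trans d.2.symm))
    ext ⟨c, hc⟩ ⟨d, hd⟩
    exact (hdiag c d (hc.trans hd.symm)).2
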